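/- Uniform Neumann bound: under the conditions of the uniform deviation lemma, if κ ≥ 2(√(2c₁) + γ) for some γ > 0, then for some constant C depending on κ, γ, δ: E[ sup_{u∈ℝ} |1/φ̌_n(u) − 1/φ(u)|² / ( ((log n) w(u)^{−2} n^{−1} / |φ(u)|⁴) ∧ (1/|φ(u)|²) ) ] ≤ C. -/

import Mathlib

open MeasureTheory

theorem aux_T (x y : ℂ) (hx : x ≠ 0) (hy : y ≠ 0) (q : ℝ) (hq : 0 < q) :
    ‖x⁻¹ - y⁻¹‖ ^ 2 / min (q / ‖y‖ ^ 4) (1 / ‖y‖ ^ 2)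
      = (‖y - x‖ / ‖x‖) ^ 2 * max (‖y‖ ^ 2 / q) 1 := by
  have hx' : 0 < ‖x‖ := norm_pos_iff.mpr hx
  have hy' : 0 < ‖y‖ := norm_pos_iff.mpr hy
  have h1 : ‖x⁻¹ - y⁻¹‖ = ‖y - x‖ / (‖x‖ * ‖y‖) := by
    rw [inv_sub_inv hx hy, norm_div, norm_mul]
  rw [h1]
  rcases le_total q (‖y‖ ^ 2) with h | h
  · rw [min_eq_left, max_eq_left]
    · field_simp
    · rw [le_div_iff₀ hq]; linarith
    · rw [div_le_div_iff₀ (by positivity) (by positivity)]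
      nlinarith [sq_nonneg (‖y‖)]
  · rw [min_eq_right, max_eq_right]
    · field_simp
    · rw [div_le_iff₀ hq]; linarith
    · rw [div_le_div_iff₀ (by positivity) (by positivity)]
      nlinarith [sq_nonneg (‖y‖)]

theorem aux_good (h y x : ℂ) (q κ a : ℝ) (hq : 0 < q) (ha : 0 < a)
    (haq : a ^ 2 = κ ^ 2 * q)
    (hx : x = if a ≤ ‖h‖ then h else ((a : ℝ) : ℂ)) (hd : ‖h - y‖ ≤ a / 2) :
    (‖y - x‖ / ‖x‖) ^ 2 * max (‖y‖ ^ 2 / q) 1 ≤ 25 / 4 * (9 / 4 * κ ^ 2 + 1) := by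
  have hyh : ‖y‖ ≤ ‖h‖ + a / 2 := by
    have := norm_sub_norm_le y h
    rw [norm_sub_rev] at this
    linarith
  have hmax : max (‖y‖ ^ 2 / q) 1 ≤ ‖y‖ ^ 2 / q + 1 :=
    max_le (by linarith) (by have : 0 ≤ ‖y‖ ^ 2 / q := by positivity
                             linarith)
  refine (mul_le_mul_of_nonneg_left hmax (by positivity)).trans ?_
  have hκ2 : κ ^ 2 = a ^ 2 / q := by rw [haq]; field_simp
  split_ifs at hx with hc
  · subst hx
    have hxp : 0 < ‖x‖ := lt_of_lt_of_le ha hc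
    rw [norm_sub_rev]
    have e1 : ‖x - y‖ / ‖x‖ ≤ 1 / 2 := by
      rw [div_le_iff₀ hxp]; linarith
    have e2 : ‖x - y‖ / ‖x‖ * ‖y‖ ≤ 3 / 4 * a := by
      rw [div_mul_eq_mul_div, div_le_iff₀ hxp]
      have : ‖x - y‖ * ‖y‖ ≤ (a / 2) * (3 / 2 * ‖x‖) :=
        mul_le_mul hd (by linarith) (norm_nonneg _) (by linarith)
      linarith
    have e1' : (‖x - y‖ / ‖x‖) ^ 2 ≤ (1 / 2) ^ 2 := pow_le_pow_left₀ (by positivity) e1 2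
    have e2' : (‖x - y‖ / ‖x‖ * ‖y‖) ^ 2 ≤ (3 / 4 * a) ^ 2 :=
      pow_le_pow_left₀ (by positivity) e2 2
    have e3 : (‖x - y‖ / ‖x‖ * ‖y‖) ^ 2 / q ≤ 9 / 16 * κ ^ 2 := by
      rw [div_le_iff₀ hq]; nlinarith
    have e4 : (‖x - y‖ / ‖x‖) ^ 2 * (‖y‖ ^ 2 / q + 1)
        = (‖x - y‖ / ‖x‖ * ‖y‖) ^ 2 / q + (‖x - y‖ / ‖x‖) ^ 2 := by ring
    rw [e4]
    nlinarith [sq_nonneg κ]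
  · push Not at hc
    have hxn : ‖x‖ = a := by rw [hx, Complex.norm_real, Real.norm_of_nonneg ha.le]
    have hy2 : ‖y‖ ≤ 3 / 2 * a := by linarith
    have e1 : ‖y - x‖ / ‖x‖ ≤ 5 / 2 := by
      rw [hxn, div_le_iff₀ ha]
      have := norm_sub_le y x
      linarith
    have e1' : (‖y - x‖ / ‖x‖) ^ 2 ≤ (5 / 2) ^ 2 := pow_le_pow_left₀ (by positivity) e1 2
    have e2' : ‖y‖ ^ 2 ≤ (3 / 2 * a) ^ 2 := pow_le_pow_left₀ (by positivity) hy2 2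
    have e3 : ‖y‖ ^ 2 / q ≤ 9 / 4 * κ ^ 2 := by
      rw [div_le_iff₀ hq]; nlinarith
    calc _ ≤ (5 / 2 : ℝ) ^ 2 * (9 / 4 * κ ^ 2 + 1) :=
          mul_le_mul e1' (by linarith) (by positivity) (by positivity)
      _ = _ := by ring

theorem aux_bad (y x : ℂ) (q κ a S : ℝ) (hq : 0 < q) (ha : 0 < a) (hκ : 0 < κ)
    (haq : a ^ 2 = κ ^ 2 * q) (hx : a ≤ ‖x‖) (hS : ‖y‖ ^ 2 / q ≤ S) :
    (‖y - x‖ / ‖x‖) ^ 2 * max (‖y‖ ^ 2 / q) 1 ≤ 2 * (S / κ ^ 2 + 1) * (S + 1) := by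
  have hS0 : 0 ≤ S := le_trans (by positivity) hS
  have hxp : 0 < ‖x‖ := lt_of_lt_of_le ha hx
  have h1 : ‖y - x‖ / ‖x‖ ≤ ‖y‖ / a + 1 := by
    rw [div_le_iff₀ hxp]
    have h2 := norm_sub_le y x
    have h3 : ‖y‖ ≤ ‖y‖ / a * ‖x‖ := by
      rw [div_mul_eq_mul_div, le_div_iff₀ ha]
      exact mul_le_mul_of_nonneg_left hx (norm_nonneg _)
    linarith
  have h2 : (‖y - x‖ / ‖x‖) ^ 2 ≤ (‖y‖ / a + 1) ^ 2 := pow_le_pow_left₀ (by positivity) h1 2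
  have h3 : (‖y‖ / a) ^ 2 ≤ S / κ ^ 2 := by
    rw [div_pow, haq, le_div_iff₀ (by positivity)]
    calc _ = ‖y‖ ^ 2 / q := by field_simp
      _ ≤ S := hS
  refine mul_le_mul ?_ (max_le (by linarith) (by linarith)) (by positivity) (by positivity)
  nlinarith [sq_nonneg (‖y‖ / a - 1)]

theorem aux_N (c1 g c CNR : ℝ) (hc1 : 0 < c1) (hg : 0 < g) (hc : 0 < c) :
    ∃ N : ℕ, ∀ n : ℕ, N ≤ n →
      2 * CNR ≤ g * Real.sqrt (Real.log n) ∧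
      Real.sqrt (Real.log n / n) ≤ Real.sqrt (2 * c1) / (2 * c) := by
  have t1 : Filter.Tendsto (fun n : ℕ => g * Real.sqrt (Real.log n)) Filter.atTop Filter.atTop :=
    Filter.Tendsto.const_mul_atTop hg
      (Real.tendsto_sqrt_atTop.comp (Real.tendsto_log_atTop.comp tendsto_natCast_atTop_atTop))
  have t2 : Filter.Tendsto (fun n : ℕ => Real.sqrt (Real.log n / n)) Filter.atTop (nhds 0) := by
    have h := (Real.isLittleO_log_id_atTop.tendsto_div_nhds_zero).comp
      (tendsto_natCast_atTop_atTop (R := ℝ))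
    have := (Real.continuous_sqrt.tendsto 0).comp h
    rw [Real.sqrt_zero] at this
    exact this
  have hp : 0 < Real.sqrt (2 * c1) / (2 * c) := by positivity
  have := (t1.eventually_ge_atTop (2 * CNR)).and (t2.eventually_le_const hp)
  exact Filter.eventually_atTop.mp this

/-- Uniform Neumann bound: if `κ ≥ 2(√(2c₁) + γ)`, then under the hypotheses of
the uniform deviation lemma,
`E[ sup_u |1/φ̌_n(u) − 1/φ(u)|² / (((log n) w(u)^{−2} n^{−1}/|φ(u)|⁴) ∧ (1/|φ(u)|²)) ] ≤ C`
for a constant `C` depending on `κ, γ, δ`. -/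
theorem uniform_neumann_bound
    (δ γ c1 CNR κ : ℝ) (hδ : 0 < δ) (hγ : 0 < γ) (hc1 : 0 < c1) (hCNR : 0 < CNR)
    (c2 : ℝ → ℝ) (hc2 : ∀ ε : ℝ, 0 < ε → 0 < c2 ε)
    (hκ : 2 * (Real.sqrt (2 * c1) + γ) ≤ κ) :
    ∃ C : ℝ, 0 < C ∧
      ∀ (n : ℕ), 1 ≤ n →
      ∀ (Ω : Type) (_ : MeasurableSpace Ω) (P : Measure Ω), IsProbabilityMeasure P →
      ∀ (X : Fin n → Ω → ℝ), (∀ j, Measurable (X j)) →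
      ∀ (φ : ℝ → ℂ) (hatφ : ℝ → Ω → ℂ) (w a : ℝ → ℝ) (φcheck : ℝ → Ω → ℂ),
        (∀ u : ℝ, φ u ≠ 0) →
        (∀ u : ℝ, w u = (Real.log (Real.exp 1 + |u|)) ^ (-(1 / 2 : ℝ) - δ)) →
        (∀ u : ℝ, a u = κ * Real.sqrt (Real.log n) * (w u)⁻¹ * (n : ℝ) ^ (-(1 : ℝ) / 2)) →
        (∀ (u : ℝ) (ω : Ω), hatφ u ω =
          (n : ℂ)⁻¹ * ∑ j, Complex.exp (Complex.I * u * (X j ω))) →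
        (∀ (u : ℝ) (ω : Ω), φcheck u ω =
          if a u ≤ ‖hatφ u ω‖ then hatφ u ω else ((a u : ℝ) : ℂ)) →
        (Integrable (fun ω => ⨆ u : ℝ, ‖hatφ u ω - φ u‖ * w u) P) →
        (∫ ω, (⨆ u : ℝ, ‖hatφ u ω - φ u‖ * w u) ∂P ≤ CNR * (n : ℝ) ^ (-(1 : ℝ) / 2)) →
        (∀ ε κ' : ℝ, 0 < ε → 0 < κ' →
          P {ω | (1 + ε) * (∫ ω', (⨆ u : ℝ, ‖hatφ u ω' - φ u‖ * w u) ∂P) + κ'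
                  ≤ ⨆ u : ℝ, ‖hatφ u ω - φ u‖ * w u}
            ≤ ENNReal.ofReal (2 * Real.exp (-(n : ℝ) * min (κ' ^ 2 / c1) (κ' / c2 ε)))) →
        (Integrable (fun ω => ⨆ u : ℝ,
            ‖(φcheck u ω)⁻¹ - (φ u)⁻¹‖ ^ 2
              / min ((Real.log n) * ((w u)⁻¹) ^ 2 * (n : ℝ)⁻¹ / ‖φ u‖ ^ 4)
                    (1 / ‖φ u‖ ^ 2)) P) →
        (∫ ω, (⨆ u : ℝ,
            ‖(φcheck u ω)⁻¹ - (φ u)⁻¹‖ ^ 2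
              / min ((Real.log n) * ((w u)⁻¹) ^ 2 * (n : ℝ)⁻¹ / ‖φ u‖ ^ 4)
                    (1 / ‖φ u‖ ^ 2)) ∂P) ≤ C := by
  have hs2 : 0 < Real.sqrt (2 * c1) := by positivity
  have hκ0 : 0 < κ := by linarith
  obtain ⟨N, hN⟩ := aux_N c1 γ (c2 1) CNR hc1 hγ (hc2 1 one_pos)
  have hl2 : 0 < Real.log 2 := Real.log_pos one_lt_two
  set A : ℝ := 25 / 4 * (9 / 4 * κ ^ 2 + 1) with hA
  have hA0 : 0 < A := by positivity
  set s0 : ℝ := (1 + CNR) ^ 2 / Real.log 2 with hs0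
  have hs00 : 0 < s0 := by positivity
  set K : ℝ := 2 * (s0 / κ ^ 2 + 1) * (s0 + 1) with hK
  have hK0 : 0 < K := by positivity
  refine ⟨A + 2 * K + K * (N : ℝ) ^ 2, by positivity, ?_⟩
  intro n hn Ω _ P hP X hX φ hatφ w a φc hφ hw ha hhat hφc hZint hEZ hTal hRint
  rcases Nat.lt_or_ge n 2 with hn2 | hn2
  · have : n = 1 := by omega
    subst this
    have hz : ∀ u : ℝ, (0:ℝ) ≤ 1 / ‖φ u‖ ^ 2 := fun u => by positivity
    simp only [Nat.cast_one, Real.log_one, zero_mul, zero_div, min_eq_left (hz _), div_zero,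
      ciSup_const, integral_zero]
    positivity
  have hn2' : (2:ℝ) ≤ n := by exact_mod_cast hn2
  have hn0 : (0:ℝ) < n := by linarith
  set L : ℝ := Real.log n with hL
  have hLl : Real.log 2 ≤ L := Real.log_le_log (by norm_num) hn2'
  have hL0 : 0 < L := lt_of_lt_of_le hl2 hLl
  have hlog : ∀ u : ℝ, 1 ≤ Real.log (Real.exp 1 + |u|) := fun u => by
    rw [Real.le_log_iff_exp_le (by positivity)]
    linarith [abs_nonneg u]
  have hw0 : ∀ u, 0 < w u := fun u => by
    rw [hw]; exact Real.rpow_pos_of_pos (by linarith [hlog u]) _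
  have hw1 : ∀ u, w u ≤ 1 := fun u => by
    rw [hw]; exact Real.rpow_le_one_of_one_le_of_nonpos (hlog u) (by linarith)
  have hnpow : (n:ℝ) ^ (-(1:ℝ) / 2) = (Real.sqrt n)⁻¹ := by
    rw [neg_div, Real.rpow_neg hn0.le, Real.sqrt_eq_rpow]
  rw [hnpow] at hEZ
  simp only [hnpow] at ha
  have hsn : 0 < Real.sqrt n := Real.sqrt_pos.mpr hn0
  have hsL : 0 < Real.sqrt L := Real.sqrt_pos.mpr hL0
  have hsn2 : Real.sqrt n ^ 2 = n := Real.sq_sqrt hn0.le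
  have hsL2 : Real.sqrt L ^ 2 = L := Real.sq_sqrt hL0.le
  have ha0 : ∀ u, 0 < a u := fun u => by
    have := hw0 u
    rw [ha]; positivity
  set q : ℝ → ℝ := fun u => L * ((w u)⁻¹) ^ 2 * (n : ℝ)⁻¹ with hq
  have hq0 : ∀ u, 0 < q u := fun u => by
    have := hw0 u
    simp only [hq]; positivity
  have haq : ∀ u, a u ^ 2 = κ ^ 2 * q u := fun u => by
    simp only [ha, hq, mul_pow, hsL2, inv_pow, hsn2]; ring
  have hhat1 : ∀ u ω, ‖hatφ u ω‖ ≤ 1 := fun u ω => by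
    rw [hhat, norm_mul, norm_inv, Complex.norm_natCast, inv_mul_le_iff₀ hn0, mul_one]
    refine (norm_sum_le _ _).trans ?_
    have : ∀ j : Fin n, ‖Complex.exp (Complex.I * u * (X j ω))‖ = 1 := fun j => by
      rw [mul_assoc, ← Complex.ofReal_mul, mul_comm]
      exact Complex.norm_exp_ofReal_mul_I _
    simp [this]
  have hxa : ∀ u ω, a u ≤ ‖φc u ω‖ := fun u ω => by
    rw [hφc]; split_ifs with h
    · exact h
    · rw [Complex.norm_real, Real.norm_of_nonneg (ha0 u).le]
  have hx1 : ∀ u ω, ‖φc u ω‖ ≤ a u + 1 := fun u ω => by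
    rw [hφc]; split_ifs with h
    · linarith [hhat1 u ω, ha0 u]
    · rw [Complex.norm_real, Real.norm_of_nonneg (ha0 u).le]; linarith
  have hx0 : ∀ u ω, φc u ω ≠ 0 := fun u ω => norm_pos_iff.mp ((ha0 u).trans_le (hxa u ω))
  have hT : ∀ u ω, ‖(φc u ω)⁻¹ - (φ u)⁻¹‖ ^ 2
      / min (L * ((w u)⁻¹) ^ 2 * (n : ℝ)⁻¹ / ‖φ u‖ ^ 4) (1 / ‖φ u‖ ^ 2)
      = (‖φ u - φc u ω‖ / ‖φc u ω‖) ^ 2 * max (‖φ u‖ ^ 2 / q u) 1 := fun u ω =>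
    aux_T _ _ (hx0 u ω) (hφ u) (q u) (hq0 u)
  simp only [hT] at hRint ⊢
  by_cases H : ∃ M0, ∀ u, ‖φ u‖ * w u ≤ M0
  swap
  · have hR0 : ∀ ω, (⨆ u : ℝ, (‖φ u - φc u ω‖ / ‖φc u ω‖) ^ 2 * max (‖φ u‖ ^ 2 / q u) 1) = 0 := by
      intro ω
      apply Real.iSup_of_not_bddAbove
      rintro ⟨B, hB⟩
      apply H
      have hB' : ∀ u, (‖φ u - φc u ω‖ / ‖φc u ω‖) ^ 2 ≤ B := fun u =>
        (le_mul_of_one_le_right (by positivity) (le_max_right _ _)).trans (hB ⟨u, rfl⟩)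
      refine ⟨(Real.sqrt B + 1) * (κ * Real.sqrt L * (Real.sqrt n)⁻¹ + 1), fun u => ?_⟩
      have hxp : 0 < ‖φc u ω‖ := (ha0 u).trans_le (hxa u ω)
      have h1 : ‖φ u - φc u ω‖ / ‖φc u ω‖ ≤ Real.sqrt B := Real.le_sqrt_of_sq_le (hB' u)
      rw [div_le_iff₀ hxp] at h1
      have h2 := norm_sub_norm_le (φ u) (φc u ω)
      have h3 : ‖φ u‖ ≤ (Real.sqrt B + 1) * ‖φc u ω‖ := by linarith
      have h4 : ‖φc u ω‖ * w u ≤ κ * Real.sqrt L * (Real.sqrt n)⁻¹ + 1 := by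
        calc _ ≤ (a u + 1) * w u := mul_le_mul_of_nonneg_right (hx1 u ω) (hw0 u).le
          _ = κ * Real.sqrt L * (Real.sqrt n)⁻¹ + w u := by
            rw [ha]; have := (hw0 u).ne'; field_simp
          _ ≤ _ := by linarith [hw1 u]
      calc _ ≤ (Real.sqrt B + 1) * ‖φc u ω‖ * w u := mul_le_mul_of_nonneg_right h3 (hw0 u).le
        _ = (Real.sqrt B + 1) * (‖φc u ω‖ * w u) := by ring
        _ ≤ _ := mul_le_mul_of_nonneg_left h4 (by positivity)
    simp only [hR0, integral_zero]
    positivity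
  obtain ⟨M0, hM0⟩ := H
  set Z : Ω → ℝ := fun ω => ⨆ u : ℝ, ‖hatφ u ω - φ u‖ * w u with hZ
  have hZle : ∀ ω u, ‖hatφ u ω - φ u‖ * w u ≤ Z ω := by
    intro ω u
    refine le_ciSup (f := fun u => ‖hatφ u ω - φ u‖ * w u) ⟨1 + M0, ?_⟩ u
    rintro _ ⟨v, rfl⟩
    have h1 := norm_sub_le (hatφ v ω) (φ v)
    calc _ ≤ (‖hatφ v ω‖ + ‖φ v‖) * w v := mul_le_mul_of_nonneg_right h1 (hw0 v).le
      _ = ‖hatφ v ω‖ * w v + ‖φ v‖ * w v := by ring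
      _ ≤ 1 + M0 := add_le_add (mul_le_one₀ (hhat1 v ω) (hw0 v).le (hw1 v)) (hM0 v)
  have hsn1 : (Real.sqrt n)⁻¹ ≤ 1 := inv_le_one_of_one_le₀ (Real.one_le_sqrt.mpr (by linarith))
  have hM : ∀ u, ‖φ u‖ * w u ≤ 1 + CNR := by
    obtain ⟨ω, hω⟩ : ∃ ω, Z ω ≤ ∫ ω, Z ω ∂P := exists_le_integral hZint
    intro u
    have h1 : ‖φ u‖ ≤ ‖hatφ u ω‖ + ‖hatφ u ω - φ u‖ := by
      have := norm_sub_norm_le (φ u) (hatφ u ω)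
      rw [norm_sub_rev] at this; linarith
    calc _ ≤ (‖hatφ u ω‖ + ‖hatφ u ω - φ u‖) * w u := mul_le_mul_of_nonneg_right h1 (hw0 u).le
      _ = ‖hatφ u ω‖ * w u + ‖hatφ u ω - φ u‖ * w u := by ring
      _ ≤ 1 + CNR := add_le_add (mul_le_one₀ (hhat1 u ω) (hw0 u).le (hw1 u))
          ((hZle ω u).trans (hω.trans (hEZ.trans (mul_le_of_le_one_right hCNR.le hsn1))))
  have hS : ∀ u, ‖φ u‖ ^ 2 / q u ≤ s0 * n := by
    intro u
    have hwu := hw0 u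
    have e : ‖φ u‖ ^ 2 / q u = (‖φ u‖ * w u) ^ 2 / L * n := by
      simp only [hq]; field_simp
    rw [e]
    refine mul_le_mul_of_nonneg_right ?_ hn0.le
    exact div_le_div₀ (by positivity) (pow_le_pow_left₀ (by positivity) (hM u) 2) hl2 hLl
  have hRK : ∀ ω, (⨆ u : ℝ, (‖φ u - φc u ω‖ / ‖φc u ω‖) ^ 2 * max (‖φ u‖ ^ 2 / q u) 1)
      ≤ K * n ^ 2 := by
    intro ω
    refine ciSup_le fun u => ?_
    refine (aux_bad _ _ (q u) κ (a u) (s0 * n) (hq0 u) (ha0 u) hκ0 (haq u) (hxa u ω) (hS u)).trans ?_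
    have e1 : s0 * n / κ ^ 2 + 1 ≤ (s0 / κ ^ 2 + 1) * n := by
      have : s0 * n / κ ^ 2 = s0 / κ ^ 2 * n := by ring
      rw [this]; linarith
    have e2 : s0 * n + 1 ≤ (s0 + 1) * n := by linarith
    calc _ ≤ 2 * ((s0 / κ ^ 2 + 1) * n) * ((s0 + 1) * n) := by gcongr
      _ = _ := by rw [hK]; ring
  rcases Nat.lt_or_ge n N with hnN | hnN
  · calc _ ≤ ∫ _ω, K * (n:ℝ) ^ 2 ∂P := integral_mono hRint (integrable_const _) hRK
      _ = K * (n:ℝ) ^ 2 := by simp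
      _ ≤ K * (N:ℝ) ^ 2 := by
        have : (n:ℝ) ≤ N := by exact_mod_cast hnN.le
        gcongr
      _ ≤ _ := by linarith
  obtain ⟨hN1, hN2⟩ := hN n hnN
  set s : ℝ := Real.sqrt (L / n) with hs
  have hsdiv : s = Real.sqrt L * (Real.sqrt n)⁻¹ := by
    rw [hs, Real.sqrt_div hL0.le, div_eq_mul_inv]
  have hs0' : 0 < s := by rw [hsdiv]; positivity
  have hss : s ^ 2 = L / n := Real.sq_sqrt (by positivity)
  set κ' : ℝ := Real.sqrt (2 * c1) * s with hκ'
  have hκ'0 : 0 < κ' := by positivity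
  set bad : Set Ω := {ω | (1 + 1) * (∫ ω', Z ω' ∂P) + κ' ≤ Z ω} with hbad
  have hPbad : P bad ≤ ENNReal.ofReal (2 * ((n:ℝ) ^ 2)⁻¹) := by
    refine (hTal 1 κ' one_pos hκ'0).trans (ENNReal.ofReal_le_ofReal ?_)
    refine mul_le_mul_of_nonneg_left ?_ (by norm_num)
    have e : ((n:ℝ) ^ 2)⁻¹ = Real.exp (-(2 * L)) := by
      rw [Real.exp_neg, two_mul, Real.exp_add, hL, Real.exp_log hn0, sq]
    rw [e, Real.exp_le_exp, neg_mul, neg_le_neg_iff]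
    have hmin : 2 * L / n ≤ min (κ' ^ 2 / c1) (κ' / c2 1) := by
      have hc21 := hc2 1 one_pos
      refine le_min ?_ ?_
      · rw [hκ', mul_pow, Real.sq_sqrt (by positivity), hss]
        apply le_of_eq; field_simp
      · rw [le_div_iff₀ hc21, hκ', mul_div_assoc, ← hss]
        rw [le_div_iff₀ (by positivity)] at hN2
        nlinarith
    calc 2 * L = n * (2 * L / n) := by field_simp
      _ ≤ _ := mul_le_mul_of_nonneg_left hmin hn0.le
  have hgood : ∀ ω, ω ∉ bad →
      (⨆ u : ℝ, (‖φ u - φc u ω‖ / ‖φc u ω‖) ^ 2 * max (‖φ u‖ ^ 2 / q u) 1) ≤ A := by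
    intro ω hω
    have hω' : Z ω < (1 + 1) * (∫ ω', Z ω' ∂P) + κ' := not_le.mp hω
    have h1 : Z ω ≤ κ / 2 * s := by
      have h2 : 2 * CNR * (Real.sqrt n)⁻¹ ≤ γ * s := by
        rw [hsdiv, ← mul_assoc]
        exact mul_le_mul_of_nonneg_right hN1 (by positivity)
      have h3 : (Real.sqrt (2 * c1) + γ) * s ≤ κ / 2 * s :=
        mul_le_mul_of_nonneg_right (by linarith) hs0'.le
      linarith
    refine ciSup_le fun u => ?_
    refine aux_good (hatφ u ω) _ _ (q u) κ (a u) (hq0 u) (ha0 u) (haq u) (hφc u ω) ?_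
    have h2 := (hZle ω u).trans h1
    rw [← le_div_iff₀ (hw0 u)] at h2
    refine h2.trans (le_of_eq ?_)
    rw [ha, hsdiv]; ring
  set D : Set Ω := toMeasurable P bad with hD
  have hDm : MeasurableSet D := measurableSet_toMeasurable P bad
  have hPD : P.real D ≤ 2 * ((n:ℝ) ^ 2)⁻¹ := by
    rw [measureReal_def, hD, measure_toMeasurable]
    exact ENNReal.toReal_le_of_le_ofReal (by positivity) hPbad
  have hI : Integrable (D.indicator fun _ => K * (n:ℝ) ^ 2) P := (integrable_const _).indicator hDm
  calc _ ≤ ∫ ω, (A + D.indicator (fun _ => K * (n:ℝ) ^ 2) ω) ∂P := by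
        refine integral_mono hRint ((integrable_const A).add hI) fun ω => ?_
        by_cases hω : ω ∈ D
        · simp only [Set.indicator_of_mem hω]
          linarith [hRK ω]
        · simp only [Set.indicator_of_notMem hω, add_zero]
          exact hgood ω fun h => hω (subset_toMeasurable P bad h)
    _ = A + P.real D * (K * (n:ℝ) ^ 2) := by
        rw [integral_add (integrable_const A) hI, integral_indicator_const _ hDm]
        simp
    _ ≤ A + 2 * ((n:ℝ) ^ 2)⁻¹ * (K * (n:ℝ) ^ 2) := by gcongr
    _ = A + 2 * K := by field_simp
    _ ≤ _ := by
        have : 0 ≤ K * (N:ℝ) ^ 2 := by positivity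
        linarith
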